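/- Let P be a Lie superalgebra over a commutative unital ring K and let 0 → (L,0) → (M,∂) → (N,∂′) → 0 be a short exact sequence of crossed P-modules (so L is abelian with the zero structure map). Then there is an exact sequence of supermodules H̄₁(P,L) → H̄₁(P,M) → H̄₁(P,N) → H̄₀(P,L) → H̄₀(P,M) → H̄₀(P,N) → 0. -/

import Mathlib

open scoped TensorProduct

namespace SuperNA

/-- The sign `(-1)^(|α||β|)` appearing in super-algebra identities. -/
def ssign (α β : ZMod 2) : ℤ := (-1 : ℤ) ^ (α.val * β.val)

/-- A Lie superalgebra over a commutative unital ring `K`: a `ℤ/2`-graded `K`-module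
with a bilinear bracket satisfying the graded skew-symmetry, the graded Jacobi
(Leibniz form) identity, and `[x₀,x₀] = 0` for even `x₀`. -/
structure LieSuperalgebra (K : Type) [CommRing K] : Type 1 where
  carrier : Type
  [isAddCommGroup : AddCommGroup carrier]
  [isModule : Module K carrier]
  grading : ZMod 2 → Submodule K carrier
  isInternal : DirectSum.IsInternal grading
  bracket : carrier →ₗ[K] carrier →ₗ[K] carrier
  bracket_grading : ∀ (α β : ZMod 2) (x y : carrier),
    x ∈ grading α → y ∈ grading β → bracket x y ∈ grading (α + β)
  super_skew : ∀ (α β : ZMod 2) (x y : carrier), x ∈ grading α → y ∈ grading β →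
    bracket x y = -(ssign α β • bracket y x)
  super_jacobi : ∀ (α β : ZMod 2) (x y : carrier), x ∈ grading α → y ∈ grading β →
    ∀ z : carrier, bracket x (bracket y z)
      = bracket (bracket x y) z + ssign α β • bracket y (bracket x z)
  bracket_self_even : ∀ x ∈ grading 0, bracket x x = 0

attribute [instance] LieSuperalgebra.isAddCommGroup LieSuperalgebra.isModule

variable {K : Type} [CommRing K]

instance : CoeSort (LieSuperalgebra K) Type := ⟨LieSuperalgebra.carrier⟩

/-- A homomorphism of Lie superalgebras: an even linear map preserving brackets. -/
structure LieSuperHom (L M : LieSuperalgebra K) where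
  toLinear : L.carrier →ₗ[K] M.carrier
  map_grading : ∀ (α : ZMod 2), ∀ x ∈ L.grading α, toLinear x ∈ M.grading α
  map_bracket : ∀ x y, toLinear (L.bracket x y) = M.bracket (toLinear x) (toLinear y)

/-- An action of the Lie superalgebra `P` on the Lie superalgebra `M`. -/
structure LieSuperAction (P M : LieSuperalgebra K) where
  act : P.carrier →ₗ[K] M.carrier →ₗ[K] M.carrier
  act_grading : ∀ (α β : ZMod 2) (p : P.carrier) (m : M.carrier),
    p ∈ P.grading α → m ∈ M.grading β → act p m ∈ M.grading (α + β)
  act_bracket : ∀ (α β : ZMod 2) (p p' : P.carrier), p ∈ P.grading α → p' ∈ P.grading β →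
    ∀ m : M.carrier, act (P.bracket p p') m = act p (act p' m) - ssign α β • act p' (act p m)
  act_super_der : ∀ (α β : ZMod 2) (p : P.carrier) (m : M.carrier),
    p ∈ P.grading α → m ∈ M.grading β → ∀ m' : M.carrier,
    act p (M.bracket m m') = M.bracket (act p m) m' + ssign α β • M.bracket m (act p m')

/-- Two mutual actions are compatible. -/
structure AreCompatible {M N : LieSuperalgebra K}
    (aMN : LieSuperAction M N) (aNM : LieSuperAction N M) : Prop where
  compat_left : ∀ (α β : ZMod 2) (m : M.carrier) (n : N.carrier),
    m ∈ M.grading α → n ∈ N.grading β → ∀ n' : N.carrier,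
    aMN.act (aNM.act n m) n' = -(ssign α β • N.bracket (aMN.act m n) n')
  compat_right : ∀ (α β : ZMod 2) (m : M.carrier) (n : N.carrier),
    m ∈ M.grading α → n ∈ N.grading β → ∀ m' : M.carrier,
    aNM.act (aMN.act m n) m' = -(ssign α β • M.bracket (aNM.act n m) m')

/-- A crossed module of Lie superalgebras `∂ : M → P`. -/
structure CrossedModule (M P : LieSuperalgebra K) where
  act : LieSuperAction P M
  d : LieSuperHom M P
  cm_act : ∀ (p : P.carrier) (m : M.carrier), d.toLinear (act.act p m) = P.bracket p (d.toLinear m)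
  cm_peiffer : ∀ (m m' : M.carrier), act.act (d.toLinear m) m' = M.bracket m m'

/-- A morphism of crossed `P`-modules. -/
structure CMHom {P M N : LieSuperalgebra K} (cmM : CrossedModule M P) (cmN : CrossedModule N P) where
  hom : LieSuperHom M N
  equivariant : ∀ (p : P.carrier) (m : M.carrier),
    hom.toLinear (cmM.act.act p m) = cmN.act.act p (hom.toLinear m)
  comm : ∀ m : M.carrier, cmN.d.toLinear (hom.toLinear m) = cmM.d.toLinear m

/-- The data of a family of "tensor symbols" in a Lie superalgebra `Q`, indexed by pairs of
homogeneous elements of `M` and `N`, satisfying the defining relations of the non-abelian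
tensor product `M ⊗ N`. -/
structure TensorData {M N : LieSuperalgebra K}
    (aMN : LieSuperAction M N) (aNM : LieSuperAction N M) (Q : LieSuperalgebra K) where
  pair : (α β : ZMod 2) → M.grading α → N.grading β → Q.carrier
  pair_grading : ∀ (α β : ZMod 2) (m : M.grading α) (n : N.grading β),
    pair α β m n ∈ Q.grading (α + β)
  pair_smul_left : ∀ (α β : ZMod 2) (c : K) (m : M.grading α) (n : N.grading β),
    pair α β (c • m) n = c • pair α β m n
  pair_smul_right : ∀ (α β : ZMod 2) (c : K) (m : M.grading α) (n : N.grading β),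
    pair α β m (c • n) = c • pair α β m n
  pair_add_left : ∀ (α β : ZMod 2) (m m' : M.grading α) (n : N.grading β),
    pair α β (m + m') n = pair α β m n + pair α β m' n
  pair_add_right : ∀ (α β : ZMod 2) (m : M.grading α) (n n' : N.grading β),
    pair α β m (n + n') = pair α β m n + pair α β m n'
  pair_bracket_left : ∀ (α α' β : ZMod 2) (m : M.grading α) (m' : M.grading α') (n : N.grading β),
    pair (α + α') β ⟨M.bracket m.1 m'.1, M.bracket_grading α α' m.1 m'.1 m.2 m'.2⟩ n
      = pair α (α' + β) m ⟨aMN.act m'.1 n.1, aMN.act_grading α' β m'.1 n.1 m'.2 n.2⟩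
        - ssign α α' • pair α' (α + β) m' ⟨aMN.act m.1 n.1, aMN.act_grading α β m.1 n.1 m.2 n.2⟩
  pair_bracket_right : ∀ (α β β' : ZMod 2) (m : M.grading α) (n : N.grading β) (n' : N.grading β'),
    pair α (β + β') m ⟨N.bracket n.1 n'.1, N.bracket_grading β β' n.1 n'.1 n.2 n'.2⟩
      = ssign β' (α + β) • pair (β' + α) β
          ⟨aNM.act n'.1 m.1, aNM.act_grading β' α n'.1 m.1 n'.2 m.2⟩ n
        - ssign α β • pair (β + α) β'
          ⟨aNM.act n.1 m.1, aNM.act_grading β α n.1 m.1 n.2 m.2⟩ n'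
  pair_bracket_pair : ∀ (α β α' β' : ZMod 2) (m : M.grading α) (n : N.grading β)
      (m' : M.grading α') (n' : N.grading β'),
    Q.bracket (pair α β m n) (pair α' β' m' n')
      = -(ssign α β • pair (β + α) (α' + β')
          ⟨aNM.act n.1 m.1, aNM.act_grading β α n.1 m.1 n.2 m.2⟩
          ⟨aMN.act m'.1 n'.1, aMN.act_grading α' β' m'.1 n'.1 m'.2 n'.2⟩)

/-- `(T, ι)` is *the* non-abelian tensor product `M ⊗ N`: it is initial among Lie
superalgebras equipped with tensor symbols satisfying the defining relations.  This
universal property characterizes the Lie superalgebra presented by the generators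
`m ⊗ n` and the relations of the non-abelian tensor product, uniquely up to isomorphism. -/
def IsNATensor {M N : LieSuperalgebra K} (aMN : LieSuperAction M N) (aNM : LieSuperAction N M)
    (T : LieSuperalgebra K) (ι : TensorData aMN aNM T) : Prop :=
  ∀ (Q : LieSuperalgebra K) (d : TensorData aMN aNM Q),
    ∃! f : LieSuperHom T Q,
      ∀ (α β : ZMod 2) (m : M.grading α) (n : N.grading β),
        f.toLinear (ι.pair α β m n) = d.pair α β m n

/-- Tensor-symbol data additionally satisfying the relations of the non-abelian
exterior square `L ∧ L` (relative to an action `a` of `L` on itself). -/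
structure ExtSqData {L : LieSuperalgebra K} (a : LieSuperAction L L) (Q : LieSuperalgebra K)
    extends TensorData a a Q where
  pair_alt : ∀ (α β : ZMod 2) (x : L.grading α) (y : L.grading β),
    toTensorData.pair α β x y + ssign α β • toTensorData.pair β α y x = 0
  pair_self : ∀ x : L.grading 0, toTensorData.pair 0 0 x x = 0

/-- `(E, ι)` is the non-abelian exterior square `L ∧ L`. -/
def IsNAExtSq {L : LieSuperalgebra K} (a : LieSuperAction L L) (E : LieSuperalgebra K)
    (ι : ExtSqData a E) : Prop :=
  ∀ (Q : LieSuperalgebra K) (d : ExtSqData a Q),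
    ∃! f : LieSuperHom E Q,
      ∀ (α β : ZMod 2) (x : L.grading α) (y : L.grading β),
        f.toLinear (ι.pair α β x y) = d.pair α β x y

/-- Generating family for a free Lie superalgebra on a graded set. -/
structure FreeData (X : Type) (degX : X → ZMod 2) (F : LieSuperalgebra K) where
  gen : X → F.carrier
  gen_grading : ∀ x, gen x ∈ F.grading (degX x)

/-- `F` (with generators `i`) is the free Lie superalgebra on the graded set `(X, degX)`. -/
def IsFreeLieSuper {X : Type} (degX : X → ZMod 2) (F : LieSuperalgebra K)
    (i : FreeData X degX F) : Prop :=
  ∀ (M : LieSuperalgebra K) (j : FreeData X degX M),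
    ∃! h : LieSuperHom F M, ∀ x, h.toLinear (i.gen x) = j.gen x

/-- The submodule spanned by brackets `[S, T]`. -/
def bracketSpan (L : LieSuperalgebra K) (S T : Submodule K L.carrier) :
    Submodule K L.carrier :=
  Submodule.span K {z | ∃ x ∈ S, ∃ y ∈ T, z = L.bracket x y}

/-- Lower central series of a (sub-)Lie superalgebra `S ⊆ L`: `lcs 0 = S`,
`lcs (n+1) = [S, lcs n]`.  `S` is nilpotent of class `≤ c` iff `lcs c = ⊥`. -/
def lcs (L : LieSuperalgebra K) (S : Submodule K L.carrier) : ℕ → Submodule K L.carrier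
  | 0 => S
  | n + 1 => bracketSpan L S (lcs L S n)

/-- Derived series of `S ⊆ L`.  `S` is solvable of derived length `≤ c` iff `ds c = ⊥`. -/
def ds (L : LieSuperalgebra K) (S : Submodule K L.carrier) : ℕ → Submodule K L.carrier
  | 0 => S
  | n + 1 => bracketSpan L (ds L S n) (ds L S n)

/-- `S ⊆ L` is `n`-Engel: `ad(x)ⁿ = 0` on `S` for every `x ∈ S`. -/
def IsEngel (L : LieSuperalgebra K) (S : Submodule K L.carrier) (n : ℕ) : Prop :=
  ∀ x ∈ S, ∀ y ∈ S, ((L.bracket x) ^ n) y = 0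

section Grading

variable {V W : Type} [AddCommGroup V] [Module K V] [AddCommGroup W] [Module K W]

/-- The induced grading on a submodule. -/
def gradeSub (g : ZMod 2 → Submodule K V) (S : Submodule K V) : ZMod 2 → Submodule K S :=
  fun α => (g α).comap S.subtype

/-- The induced grading on a quotient module. -/
def gradeQuot (g : ZMod 2 → Submodule K V) (S : Submodule K V) : ZMod 2 → Submodule K (V ⧸ S) :=
  fun α => (g α).map S.mkQ

/-- The induced grading on a tensor product of supermodules. -/
def gradeTensor (gV : ZMod 2 → Submodule K V) (gW : ZMod 2 → Submodule K W) :
    ZMod 2 → Submodule K (V ⊗[K] W) :=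
  fun γ => Submodule.span K {t | ∃ (α β : ZMod 2) (v : V) (w : W),
    α + β = γ ∧ v ∈ gV α ∧ w ∈ gW β ∧ t = v ⊗ₜ[K] w}

/-- A linear equivalence is an isomorphism of supermodules for the given gradings. -/
def SuperEquiv (gV : ZMod 2 → Submodule K V) (gW : ZMod 2 → Submodule K W)
    (e : V ≃ₗ[K] W) : Prop :=
  ∀ α, (gV α).map e.toLinearMap = gW α

end Grading

/-- An associative (unital) superalgebra over `K`. -/
structure AssocSuperalgebra (K : Type) [CommRing K] : Type 1 where
  carrier : Type
  [isRing : Ring carrier]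
  [isAlgebra : Algebra K carrier]
  grading : ZMod 2 → Submodule K carrier
  isInternal : DirectSum.IsInternal grading
  grading_mul : ∀ (α β : ZMod 2) (x y : carrier),
    x ∈ grading α → y ∈ grading β → x * y ∈ grading (α + β)
  one_mem : (1 : carrier) ∈ grading 0

attribute [instance] AssocSuperalgebra.isRing AssocSuperalgebra.isAlgebra

/-- A (not necessarily unital) associative superalgebra over `K`. -/
structure NuAssocSuperalgebra (K : Type) [CommRing K] : Type 1 where
  carrier : Type
  [isRing : NonUnitalRing carrier]
  [isModule : Module K carrier]
  [isTower : IsScalarTower K carrier carrier]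
  [isComm : SMulCommClass K carrier carrier]
  grading : ZMod 2 → Submodule K carrier
  isInternal : DirectSum.IsInternal grading
  grading_mul : ∀ (α β : ZMod 2) (x y : carrier),
    x ∈ grading α → y ∈ grading β → x * y ∈ grading (α + β)

attribute [instance] NuAssocSuperalgebra.isRing NuAssocSuperalgebra.isModule
  NuAssocSuperalgebra.isTower NuAssocSuperalgebra.isComm

/-- The super-alternating relations inside `L ⊗ L`, whose quotient is `Λ²(L)`. -/
def altRel (L : LieSuperalgebra K) : Submodule K (L.carrier ⊗[K] L.carrier) :=
  Submodule.span K {t | ∃ (α β : ZMod 2) (x : L.grading α) (y : L.grading β),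
    t = x.1 ⊗ₜ[K] y.1 + ssign α β • (y.1 ⊗ₜ[K] x.1)}

/-- The super-alternating relations inside `L ⊗ (L ⊗ L)`, whose quotient is `Λ³(L)`. -/
def altRel3 (L : LieSuperalgebra K) :
    Submodule K (L.carrier ⊗[K] (L.carrier ⊗[K] L.carrier)) :=
  Submodule.span K
    ({t | ∃ (x : L.carrier) (r : L.carrier ⊗[K] L.carrier), r ∈ altRel L ∧ t = x ⊗ₜ[K] r} ∪
     {t | ∃ (α β : ZMod 2) (x : L.grading α) (y : L.grading β) (z : L.carrier),
        t = x.1 ⊗ₜ[K] (y.1 ⊗ₜ[K] z) + ssign α β • (y.1 ⊗ₜ[K] (x.1 ⊗ₜ[K] z))})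


section Homogeneous

variable (L : LieSuperalgebra K)

/-- A submodule is homogeneous when it contains the components of each of its elements. -/
def IsHomogeneousSub (S : Submodule K L.carrier) : Prop :=
  S ≤ (S ⊓ L.grading 0) ⊔ (S ⊓ L.grading 1)

lemma zmod_two_univ : (Set.univ : Set (ZMod 2)) = {0, 1} := by
  ext a
  simp only [Set.mem_univ, Set.mem_insert_iff, Set.mem_singleton_iff, true_iff]
  revert a
  decide

lemma isInternal_iff_isCompl {V : Type} [AddCommGroup V] [Module K V]
    (A : ZMod 2 → Submodule K V) : DirectSum.IsInternal A ↔ IsCompl (A 0) (A 1) :=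
  DirectSum.isInternal_submodule_iff_isCompl A (by decide) zmod_two_univ

lemma isCompl_grading : IsCompl (L.grading 0) (L.grading 1) :=
  (isInternal_iff_isCompl _).1 L.isInternal

lemma exists_homogeneous_add (x : L.carrier) :
    ∃ a ∈ L.grading 0, ∃ b ∈ L.grading 1, a + b = x :=
  Submodule.mem_sup.1 <| (isCompl_grading L).sup_eq_top ▸ Submodule.mem_top

variable {L} in
lemma eq_of_homogeneous_add_eq {a a' b b' : L.carrier} (ha : a ∈ L.grading 0)
    (ha' : a' ∈ L.grading 0) (hb : b ∈ L.grading 1) (hb' : b' ∈ L.grading 1)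
    (h : a + b = a' + b') : a = a' ∧ b = b' := by
  have h₁ : a - a' = b' - b := by
    rw [sub_eq_sub_iff_add_eq_add, h, add_comm]
  have h₀ : a - a' = 0 := (Submodule.disjoint_def.1 (isCompl_grading L).disjoint) _
    (sub_mem ha ha') (h₁ ▸ sub_mem hb' hb)
  exact ⟨sub_eq_zero.1 h₀, (sub_eq_zero.1 (h₁.symm.trans h₀)).symm⟩

lemma isHomogeneousSub_span {s : Set L.carrier} (hs : ∀ x ∈ s, ∃ α, x ∈ L.grading α) :
    IsHomogeneousSub L (Submodule.span K s) := by
  refine Submodule.span_le.2 fun x hx => ?_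
  obtain ⟨α, hα⟩ := hs x hx
  have hx' := Submodule.subset_span (R := K) hx
  fin_cases α
  · exact Submodule.mem_sup_left ⟨hx', hα⟩
  · exact Submodule.mem_sup_right ⟨hx', hα⟩

lemma isHomogeneousSub_range {L M : LieSuperalgebra K} (f : LieSuperHom L M) :
    IsHomogeneousSub M (LinearMap.range f.toLinear) := by
  rintro _ ⟨x, rfl⟩
  obtain ⟨a, ha, b, hb, rfl⟩ := exists_homogeneous_add L x
  rw [map_add]
  exact Submodule.add_mem_sup ⟨⟨a, rfl⟩, f.map_grading 0 a ha⟩ ⟨⟨b, rfl⟩, f.map_grading 1 b hb⟩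

/-- If the image of `x` under an even map is homogeneous, it is also the image of a
homogeneous element of the same degree. -/
lemma exists_homogeneous_preimage {L M : LieSuperalgebra K} (f : LieSuperHom L M) (α : ZMod 2)
    (x : L.carrier) (hx : f.toLinear x ∈ M.grading α) :
    ∃ y ∈ L.grading α, f.toLinear y = f.toLinear x := by
  obtain ⟨a, ha, b, hb, rfl⟩ := exists_homogeneous_add L x
  have ha' := f.map_grading 0 a ha
  have hb' := f.map_grading 1 b hb
  fin_cases α
  · exact ⟨a, ha, (eq_of_homogeneous_add_eq ha' hx hb' (zero_mem _)
      (by rw [map_add, add_zero])).1⟩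
  · exact ⟨b, hb, (eq_of_homogeneous_add_eq ha' (zero_mem _) hb' hx
      (by rw [map_add, zero_add])).2⟩

end Homogeneous

/-- The Lie superalgebra structure on a homogeneous submodule closed under the bracket. -/
def LieSuperalgebra.restrict (L : LieSuperalgebra K) (S : Submodule K L.carrier)
    (hS : IsHomogeneousSub L S) (hb : ∀ x ∈ S, ∀ y ∈ S, L.bracket x y ∈ S) :
    LieSuperalgebra K where
  carrier := S
  grading := gradeSub L.grading S
  isInternal := by
    rw [isInternal_iff_isCompl]
    constructor
    · rw [Submodule.disjoint_def]
      intro x h₀ h₁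
      exact Subtype.ext (Submodule.disjoint_def.1 (isCompl_grading L).disjoint x.1 h₀ h₁)
    · rw [codisjoint_iff, eq_top_iff]
      rintro ⟨x, hx⟩ -
      obtain ⟨a, ha, b, hb, rfl⟩ := Submodule.mem_sup.1 (hS hx)
      exact Submodule.mem_sup.2 ⟨⟨a, ha.1⟩, ha.2, ⟨b, hb.1⟩, hb.2, rfl⟩
  bracket := LinearMap.mk₂ K (fun x y => ⟨L.bracket x.1 y.1, hb x.1 x.2 y.1 y.2⟩)
    (fun _ _ _ => Subtype.ext (by simp)) (fun _ _ _ => Subtype.ext (by simp))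
    (fun _ _ _ => Subtype.ext (by simp)) (fun _ _ _ => Subtype.ext (by simp))
  bracket_grading α β x y hx hy := L.bracket_grading α β x.1 y.1 hx hy
  super_skew α β x y hx hy := Subtype.ext (L.super_skew α β x.1 y.1 hx hy)
  super_jacobi α β x y hx hy z := Subtype.ext (L.super_jacobi α β x.1 y.1 hx hy z.1)
  bracket_self_even x hx := Subtype.ext (L.bracket_self_even x.1 hx)

/-- The inclusion of a Lie sub-superalgebra. -/
def LieSuperalgebra.restrictSubtype (L : LieSuperalgebra K) (S : Submodule K L.carrier)
    (hS : IsHomogeneousSub L S) (hb : ∀ x ∈ S, ∀ y ∈ S, L.bracket x y ∈ S) :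
    LieSuperHom (L.restrict S hS hb) L where
  toLinear := S.subtype
  map_grading _ _ hx := hx
  map_bracket _ _ := rfl

section Quotient

variable (L : LieSuperalgebra K) (I : Submodule K L.carrier)
  (hl : ∀ x ∈ I, ∀ y, L.bracket x y ∈ I) (hr : ∀ x, ∀ y ∈ I, L.bracket x y ∈ I)

/-- The bracket induced on the quotient by an ideal. -/
def quotBracket : (L.carrier ⧸ I) →ₗ[K] (L.carrier ⧸ I) →ₗ[K] (L.carrier ⧸ I) :=
  I.liftQ (I.liftQ (L.bracket.compr₂ I.mkQ).flip (fun y hy => by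
      ext x
      simpa using hr x y hy)).flip (fun x hx => by
    ext y
    exact (Submodule.Quotient.mk_eq_zero I).2 (hl x hx y))

/-- The quotient of a Lie superalgebra by a homogeneous ideal. -/
def LieSuperalgebra.quot (hI : IsHomogeneousSub L I) : LieSuperalgebra K where
  carrier := L.carrier ⧸ I
  grading := gradeQuot L.grading I
  isInternal := by
    rw [isInternal_iff_isCompl]
    constructor
    · rw [Submodule.disjoint_def]
      rintro _ ⟨a, ha, rfl⟩ ⟨b, hb, hab⟩
      have hmem : a - b ∈ I := (Submodule.Quotient.eq I).1 hab.symm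
      obtain ⟨a', ha', b', hb', h⟩ := Submodule.mem_sup.1 (hI hmem)
      have := (eq_of_homogeneous_add_eq ha'.2 ha hb'.2 (neg_mem hb)
        (h.trans (sub_eq_add_neg a b))).1
      exact (Submodule.Quotient.mk_eq_zero I).2 (this ▸ ha'.1)
    · rw [codisjoint_iff, gradeQuot, gradeQuot, ← Submodule.map_sup,
        (isCompl_grading L).sup_eq_top, Submodule.map_top, Submodule.range_mkQ]
  bracket := quotBracket L I hl hr
  bracket_grading := by
    rintro α β _ _ ⟨x, hx, rfl⟩ ⟨y, hy, rfl⟩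
    exact ⟨L.bracket x y, L.bracket_grading α β x y hx hy, rfl⟩
  super_skew := by
    rintro α β _ _ ⟨x, hx, rfl⟩ ⟨y, hy, rfl⟩
    exact congrArg I.mkQ (L.super_skew α β x y hx hy)
  super_jacobi := by
    rintro α β _ _ ⟨x, hx, rfl⟩ ⟨y, hy, rfl⟩ z
    obtain ⟨z, rfl⟩ := I.mkQ_surjective z
    exact congrArg I.mkQ (L.super_jacobi α β x y hx hy z)
  bracket_self_even := by
    rintro _ ⟨x, hx, rfl⟩
    exact (congrArg I.mkQ (L.bracket_self_even x hx)).trans (map_zero _)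

end Quotient

section Tensor

variable {M N T : LieSuperalgebra K} {aMN : LieSuperAction M N} {aNM : LieSuperAction N M}

/-- The submodule spanned by the tensor symbols. -/
def TensorData.pairSpan (ι : TensorData aMN aNM T) : Submodule K T.carrier :=
  Submodule.span K {t | ∃ (α β : ZMod 2) (m : M.grading α) (n : N.grading β), t = ι.pair α β m n}

lemma TensorData.pair_mem_pairSpan (ι : TensorData aMN aNM T) (α β : ZMod 2)
    (m : M.grading α) (n : N.grading β) : ι.pair α β m n ∈ ι.pairSpan :=
  Submodule.subset_span ⟨α, β, m, n, rfl⟩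

lemma TensorData.bracket_mem_pairSpan (ι : TensorData aMN aNM T) :
    ∀ x ∈ ι.pairSpan, ∀ y ∈ ι.pairSpan, T.bracket x y ∈ ι.pairSpan := by
  intro x hx y hy
  suffices h : ι.pairSpan ≤ ι.pairSpan.comap (T.bracket.flip y) by exact h hx
  refine Submodule.span_le.2 ?_
  rintro _ ⟨α, β, m, n, rfl⟩
  suffices h : ι.pairSpan ≤ ι.pairSpan.comap (T.bracket (ι.pair α β m n)) by exact h hy
  refine Submodule.span_le.2 ?_
  rintro _ ⟨α', β', m', n', rfl⟩
  change T.bracket (ι.pair α β m n) (ι.pair α' β' m' n') ∈ ι.pairSpan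
  rw [ι.pair_bracket_pair]
  exact neg_mem (zsmul_mem (S := Submodule K T.carrier) (ι.pair_mem_pairSpan _ _ _ _) _)

lemma TensorData.isHomogeneousSub_pairSpan (ι : TensorData aMN aNM T) :
    IsHomogeneousSub T ι.pairSpan :=
  isHomogeneousSub_span T <| by
    rintro _ ⟨α, β, m, n, rfl⟩
    exact ⟨α + β, ι.pair_grading α β m n⟩

/-- The tensor symbols, seen in the Lie sub-superalgebra they span. -/
def TensorData.restrict (ι : TensorData aMN aNM T) :
    TensorData aMN aNM (T.restrict ι.pairSpan ι.isHomogeneousSub_pairSpan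
      ι.bracket_mem_pairSpan) where
  pair α β m n := ⟨ι.pair α β m n, ι.pair_mem_pairSpan α β m n⟩
  pair_grading := ι.pair_grading
  pair_smul_left α β c m n := Subtype.ext (ι.pair_smul_left α β c m n)
  pair_smul_right α β c m n := Subtype.ext (ι.pair_smul_right α β c m n)
  pair_add_left α β m m' n := Subtype.ext (ι.pair_add_left α β m m' n)
  pair_add_right α β m n n' := Subtype.ext (ι.pair_add_right α β m n n')
  pair_bracket_left α α' β m m' n := Subtype.ext (ι.pair_bracket_left α α' β m m' n)
  pair_bracket_right α β β' m n n' := Subtype.ext (ι.pair_bracket_right α β β' m n n')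
  pair_bracket_pair α β α' β' m n m' n' :=
    Subtype.ext (ι.pair_bracket_pair α β α' β' m n m' n')

/-- The non-abelian tensor product is spanned by its tensor symbols. -/
lemma IsNATensor.pairSpan_eq_top {ι : TensorData aMN aNM T} (h : IsNATensor aMN aNM T ι) :
    ι.pairSpan = ⊤ := by
  obtain ⟨r, hr, -⟩ := h _ ι.restrict
  let j := T.restrictSubtype ι.pairSpan ι.isHomogeneousSub_pairSpan ι.bracket_mem_pairSpan
  let jr : LieSuperHom T T :=
    { toLinear := j.toLinear ∘ₗ r.toLinear
      map_grading := fun α x hx => j.map_grading α _ (r.map_grading α x hx)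
      map_bracket := fun x y => by
        simp only [LinearMap.comp_apply, r.map_bracket, j.map_bracket] }
  let i : LieSuperHom T T :=
    { toLinear := LinearMap.id
      map_grading := fun _ _ hx => hx
      map_bracket := fun _ _ => rfl }
  have hij : jr = i := (h T ι).unique
    (fun α β m n => congrArg Subtype.val (hr α β m n)) (fun _ _ _ _ => rfl)
  rw [eq_top_iff]
  intro t _
  have ht : jr.toLinear t = t := by rw [hij]; rfl
  exact ht ▸ (r.toLinear t).2

lemma IsNATensor.mem_of_pair_mem {ι : TensorData aMN aNM T} (h : IsNATensor aMN aNM T ι)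
    {S : Submodule K T.carrier} (hS : ∀ α β m n, ι.pair α β m n ∈ S) (t : T.carrier) : t ∈ S := by
  have hle : ι.pairSpan ≤ S := Submodule.span_le.2 <| by
    rintro _ ⟨α, β, m, n, rfl⟩
    exact hS α β m n
  exact hle (h.pairSpan_eq_top ▸ Submodule.mem_top)

lemma IsNATensor.linearMap_ext {ι : TensorData aMN aNM T} (h : IsNATensor aMN aNM T ι)
    {V : Type} [AddCommGroup V] [Module K V] {u v : T.carrier →ₗ[K] V}
    (huv : ∀ α β m n, u (ι.pair α β m n) = v (ι.pair α β m n)) : u = v :=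
  LinearMap.ext (h.mem_of_pair_mem (S := LinearMap.eqLocus u v) huv)

lemma TensorData.pair_zero_left (ι : TensorData aMN aNM T) (α β : ZMod 2) (n : N.grading β) :
    ι.pair α β 0 n = 0 := by
  simpa using ι.pair_smul_left α β 0 0 n

lemma TensorData.pair_sub_right (ι : TensorData aMN aNM T) (α β : ZMod 2) (m : M.grading α)
    (n n' : N.grading β) : ι.pair α β m (n - n') = ι.pair α β m n - ι.pair α β m n' := by
  rw [eq_sub_iff_add_eq, ← ι.pair_add_right, sub_add_cancel]

end Tensor

section RightExact

variable {P L M N : LieSuperalgebra K}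
  {cmL : CrossedModule L P} {cmM : CrossedModule M P} {cmN : CrossedModule N P}
  {f : CMHom cmL cmM} {g : CMHom cmM cmN}
  {aLP : LieSuperAction L P} {aMP : LieSuperAction M P} {aNP : LieSuperAction N P}
  {TL TM TN : LieSuperalgebra K} {ιL : TensorData cmL.act aLP TL}
  {ιM : TensorData cmM.act aMP TM} {ιN : TensorData cmN.act aNP TN}

lemma exists_homogeneous_lift (hgSurj : Function.Surjective g.hom.toLinear) {β : ZMod 2}
    (n : N.grading β) : ∃ m : M.grading β, g.hom.toLinear m.1 = n.1 := by
  obtain ⟨m, hm⟩ := hgSurj n.1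
  obtain ⟨y, hy, hym⟩ := exists_homogeneous_preimage g.hom β m (hm ▸ n.2)
  exact ⟨⟨y, hy⟩, hym.trans hm⟩

/-- The map induced on tensor products by a surjective morphism is surjective. -/
lemma surjective_tensor_map (hgSurj : Function.Surjective g.hom.toLinear)
    (hTN : IsNATensor cmN.act aNP TN ιN) {Tg : LieSuperHom TM TN}
    (hTg : ∀ (α β : ZMod 2) (p : P.grading α) (x : M.grading β),
      Tg.toLinear (ιM.pair α β p x)
        = ιN.pair α β p ⟨g.hom.toLinear x.1, g.hom.map_grading β x.1 x.2⟩) :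
    Function.Surjective Tg.toLinear := by
  refine hTN.mem_of_pair_mem (S := LinearMap.range Tg.toLinear) fun α β p n => ?_
  obtain ⟨m, hm⟩ := exists_homogeneous_lift hgSurj n
  exact ⟨ιM.pair α β p m, (hTg α β p m).trans (congrArg _ (Subtype.ext hm))⟩

lemma pair_sub_pair_mem_range
    (hfg : LinearMap.range f.hom.toLinear = LinearMap.ker g.hom.toLinear)
    {Tf : LieSuperHom TL TM}
    (hTf : ∀ (α β : ZMod 2) (p : P.grading α) (x : L.grading β),
      Tf.toLinear (ιL.pair α β p x)
        = ιM.pair α β p ⟨f.hom.toLinear x.1, f.hom.map_grading β x.1 x.2⟩)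
    {α β : ZMod 2} (p : P.grading α) (m m' : M.grading β)
    (h : g.hom.toLinear m.1 = g.hom.toLinear m'.1) :
    ιM.pair α β p m - ιM.pair α β p m' ∈ LinearMap.range Tf.toLinear := by
  obtain ⟨l, hl⟩ : m.1 - m'.1 ∈ LinearMap.range f.hom.toLinear := by
    rw [hfg, LinearMap.mem_ker, map_sub, h, sub_self]
  obtain ⟨y, hy, hyl⟩ := exists_homogeneous_preimage f.hom β l (hl ▸ sub_mem m.2 m'.2)
  refine ⟨ιL.pair α β p ⟨y, hy⟩, ?_⟩
  rw [hTf, ← ιM.pair_sub_right]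
  exact congrArg _ (Subtype.ext (hyl.trans hl))

section Ideal

variable (hTL : IsNATensor cmL.act aLP TL ιL) (hTM : IsNATensor cmM.act aMP TM ιM)
  {Tf : LieSuperHom TL TM}
  (hTf : ∀ (α β : ZMod 2) (p : P.grading α) (x : L.grading β),
      Tf.toLinear (ιL.pair α β p x)
        = ιM.pair α β p ⟨f.hom.toLinear x.1, f.hom.map_grading β x.1 x.2⟩)

include hTL hTM hTf

/-- Bracketing with the image of `P ⊗ L` on the left vanishes if the structure map of `L` does. -/
lemma bracket_tensor_map_left (haMP : ∀ (x : M.carrier) (p : P.carrier),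
      aMP.act x p = P.bracket (cmM.d.toLinear x) p) (hL0 : cmL.d.toLinear = 0)
    (s : TL.carrier) (t : TM.carrier) : TM.bracket (Tf.toLinear s) t = 0 := by
  refine hTL.mem_of_pair_mem
    (S := LinearMap.ker (TM.bracket.flip t ∘ₗ Tf.toLinear)) (fun α β p l => ?_) s
  refine hTM.mem_of_pair_mem
    (S := LinearMap.ker (TM.bracket (Tf.toLinear (ιL.pair α β p l)))) (fun α' β' p' m => ?_) t
  have h0 : aMP.act (f.hom.toLinear l.1) p.1 = 0 := by
    rw [haMP, f.comm, hL0]; simp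
  rw [LinearMap.mem_ker, hTf, ιM.pair_bracket_pair]
  simp only [h0]
  have := ιM.pair_zero_left (β + α) (α' + β')
  rw [show ∀ h, (⟨0, h⟩ : P.grading (β + α)) = 0 from fun _ => rfl, this, smul_zero, neg_zero]

lemma bracket_tensor_map_right (t : TM.carrier) (s : TL.carrier) :
    TM.bracket t (Tf.toLinear s) ∈ LinearMap.range Tf.toLinear := by
  refine hTL.mem_of_pair_mem (S := (LinearMap.range Tf.toLinear).comap
    (TM.bracket t ∘ₗ Tf.toLinear)) (fun α β p l => ?_) s
  refine hTM.mem_of_pair_mem (S := (LinearMap.range Tf.toLinear).comap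
    (TM.bracket.flip (Tf.toLinear (ιL.pair α β p l)))) (fun α' β' p' m => ?_) t
  rw [Submodule.mem_comap, LinearMap.flip_apply, hTf, ιM.pair_bracket_pair]
  refine neg_mem (zsmul_mem ?_ _)
  refine ⟨ιL.pair _ _ _ ⟨cmL.act.act p.1 l.1, cmL.act.act_grading α β p.1 l.1 p.2 l.2⟩,
    (hTf _ _ _ _).trans (congrArg _ (Subtype.ext ?_))⟩
  exact f.equivariant p.1 l.1

end Ideal

/-- The tensor symbols `p ⊗ n` in a quotient of `P ⊗ M` by a homogeneous ideal which
identifies `p ⊗ m` and `p ⊗ m'` whenever `m` and `m'` have the same image in `N`. -/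
noncomputable def quotTensorData (hgSurj : Function.Surjective g.hom.toLinear)
    (haMP : ∀ (x : M.carrier) (p : P.carrier), aMP.act x p = P.bracket (cmM.d.toLinear x) p)
    (haNP : ∀ (x : N.carrier) (p : P.carrier), aNP.act x p = P.bracket (cmN.d.toLinear x) p)
    (ιM : TensorData cmM.act aMP TM) (I : Submodule K TM.carrier)
    (hl : ∀ x ∈ I, ∀ y, TM.bracket x y ∈ I) (hr : ∀ x, ∀ y ∈ I, TM.bracket x y ∈ I)
    (hI : IsHomogeneousSub TM I)
    (hpair : ∀ {α β : ZMod 2} (p : P.grading α) (m m' : M.grading β),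
      g.hom.toLinear m.1 = g.hom.toLinear m'.1 → ιM.pair α β p m - ιM.pair α β p m' ∈ I) :
    TensorData cmN.act aNP (TM.quot I hl hr hI) :=
  let lift {β : ZMod 2} (n : N.grading β) : M.grading β :=
    (exists_homogeneous_lift hgSurj n).choose
  have hlift {β : ZMod 2} (n : N.grading β) : g.hom.toLinear (lift n).1 = n.1 :=
    (exists_homogeneous_lift hgSurj n).choose_spec
  have key {α β : ZMod 2} (p p' : P.grading α) (n : N.grading β) (m : M.grading β)
      (hp : p.1 = p'.1) (hm : g.hom.toLinear m.1 = n.1) :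
      I.mkQ (ιM.pair α β p (lift n)) = I.mkQ (ιM.pair α β p' m) := by
    obtain rfl : p = p' := Subtype.ext hp
    exact (Submodule.Quotient.eq I).2 (hpair p _ _ ((hlift n).trans hm.symm))
  let actM {α β : ZMod 2} (p : P.grading α) (n : N.grading β) : M.grading (α + β) :=
    ⟨cmM.act.act p.1 (lift n).1, cmM.act.act_grading α β _ _ p.2 (lift n).2⟩
  let actP {α β : ZMod 2} (p : P.grading α) (n : N.grading β) : P.grading (β + α) :=
    ⟨aMP.act (lift n).1 p.1, aMP.act_grading β α _ _ (lift n).2 p.2⟩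
  have hactM {α β : ZMod 2} (p : P.grading α) (n : N.grading β) :
      g.hom.toLinear (actM p n).1 = cmN.act.act p.1 n.1 := by
    rw [g.equivariant, hlift]
  have hactP {α β : ZMod 2} (p : P.grading α) (n : N.grading β) :
      aNP.act n.1 p.1 = (actP p n).1 := by
    change _ = aMP.act (lift n).1 p.1
    rw [haNP, haMP, ← g.comm, hlift]
  { pair := fun α β p n => I.mkQ (ιM.pair α β p (lift n))
    pair_grading := fun α β p n => ⟨_, ιM.pair_grading α β p (lift n), rfl⟩
    pair_smul_left := fun α β c p n => by
      rw [ιM.pair_smul_left]; rfl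
    pair_smul_right := fun α β c p n => by
      rw [key p p (c • n) (c • lift n) rfl (by simp [hlift]), ιM.pair_smul_right]; rfl
    pair_add_left := fun α β p p' n => by
      rw [ιM.pair_add_left]; rfl
    pair_add_right := fun α β p n n' => by
      rw [key p p (n + n') (lift n + lift n') rfl (by simp [hlift]), ιM.pair_add_right]; rfl
    pair_bracket_left := fun α α' β p p' n => by
      rw [ιM.pair_bracket_left, key p p _ (actM p' n) rfl (hactM p' n),
        key p' p' _ (actM p n) rfl (hactM p n)]
      rfl
    pair_bracket_right := fun α β β' p n n' => by
      rw [key p p _ ⟨M.bracket (lift n).1 (lift n').1,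
          M.bracket_grading _ _ _ _ (lift n).2 (lift n').2⟩ rfl
          (by rw [g.hom.map_bracket, hlift, hlift]), ιM.pair_bracket_right,
        key _ (actP p n') n (lift n) (hactP p n') (hlift n),
        key _ (actP p n) n' (lift n') (hactP p n) (hlift n')]
      rfl
    pair_bracket_pair := fun α β α' β' p n p' n' => by
      rw [key _ (actP p n) _ (actM p' n') (hactP p n) (hactM p' n')]
      exact congrArg I.mkQ (ιM.pair_bracket_pair α β α' β' p (lift n) p' (lift n')) }

/-- Right exactness of `P ⊗ -` on crossed `P`-modules. -/
lemma range_tensor_map_eq_ker (hL0 : cmL.d.toLinear = 0)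
    (hgSurj : Function.Surjective g.hom.toLinear)
    (hfg : LinearMap.range f.hom.toLinear = LinearMap.ker g.hom.toLinear)
    (haMP : ∀ (x : M.carrier) (p : P.carrier), aMP.act x p = P.bracket (cmM.d.toLinear x) p)
    (haNP : ∀ (x : N.carrier) (p : P.carrier), aNP.act x p = P.bracket (cmN.d.toLinear x) p)
    (hTL : IsNATensor cmL.act aLP TL ιL) (hTM : IsNATensor cmM.act aMP TM ιM)
    (hTN : IsNATensor cmN.act aNP TN ιN) {Tf : LieSuperHom TL TM}
    (hTf : ∀ (α β : ZMod 2) (p : P.grading α) (x : L.grading β),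
      Tf.toLinear (ιL.pair α β p x)
        = ιM.pair α β p ⟨f.hom.toLinear x.1, f.hom.map_grading β x.1 x.2⟩)
    {Tg : LieSuperHom TM TN}
    (hTg : ∀ (α β : ZMod 2) (p : P.grading α) (x : M.grading β),
      Tg.toLinear (ιM.pair α β p x)
        = ιN.pair α β p ⟨g.hom.toLinear x.1, g.hom.map_grading β x.1 x.2⟩) :
    LinearMap.range Tf.toLinear = LinearMap.ker Tg.toLinear := by
  have hgf (l : L.carrier) : g.hom.toLinear (f.hom.toLinear l) = 0 :=
    LinearMap.mem_ker.1 (hfg ▸ LinearMap.mem_range_self f.hom.toLinear l)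
  apply le_antisymm
  · rw [LinearMap.range_le_ker_iff]
    refine hTL.linearMap_ext fun α β p l => ?_
    rw [LinearMap.comp_apply, hTf, hTg, LinearMap.zero_apply]
    exact (congrArg _ (Subtype.ext (by simp [hgf]))).trans
      ((ιN.pair_sub_right α β p 0 0).trans (sub_self _))
  · let I := LinearMap.range Tf.toLinear
    have hl : ∀ x ∈ I, ∀ y, TM.bracket x y ∈ I := by
      rintro _ ⟨s, rfl⟩ y
      rw [bracket_tensor_map_left hTL hTM hTf haMP hL0]
      exact zero_mem _
    have hr : ∀ x, ∀ y ∈ I, TM.bracket x y ∈ I := by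
      rintro x _ ⟨s, rfl⟩
      exact bracket_tensor_map_right hTL hTM hTf x s
    have hpair {α β : ZMod 2} (p : P.grading α) (m m' : M.grading β)
        (h : g.hom.toLinear m.1 = g.hom.toLinear m'.1) :
        ιM.pair α β p m - ιM.pair α β p m' ∈ I := pair_sub_pair_mem_range hfg hTf p m m' h
    obtain ⟨h, hh, -⟩ := hTN _ (quotTensorData hgSurj haMP haNP ιM I hl hr
      (isHomogeneousSub_range Tf) hpair)
    have hcomp : h.toLinear ∘ₗ Tg.toLinear = I.mkQ := by
      refine hTM.linearMap_ext fun α β p m => ?_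
      rw [LinearMap.comp_apply, hTg, hh]
      exact (Submodule.Quotient.eq I).2 (hpair p _ _
        (exists_homogeneous_lift hgSurj _).choose_spec)
    intro t ht
    refine (Submodule.Quotient.mk_eq_zero I).1 ?_
    have := LinearMap.congr_fun hcomp t
    rw [LinearMap.comp_apply, LinearMap.mem_ker.1 ht, map_zero] at this
    exact this.symm

end RightExact

section Snake

variable {A₁ A₂ A₃ B₁ B₂ B₃ : Type} [AddCommGroup A₁] [Module K A₁] [AddCommGroup A₂] [Module K A₂]
  [AddCommGroup A₃] [Module K A₃] [AddCommGroup B₁] [Module K B₁] [AddCommGroup B₂] [Module K B₂]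
  [AddCommGroup B₃] [Module K B₃]

/-- The six-term exact sequence of kernels and cokernels of a map from a right exact sequence
to a short exact sequence. -/
theorem exists_snake_sequence (v₁ : A₁ →ₗ[K] B₁) (v₂ : A₂ →ₗ[K] B₂) (v₃ : A₃ →ₗ[K] B₃)
    (a : A₁ →ₗ[K] A₂) (a' : A₂ →ₗ[K] A₃) (b : B₁ →ₗ[K] B₂) (b' : B₂ →ₗ[K] B₃)
    (ha : Function.Exact a a') (hb : Function.Exact b b')
    (h₁ : b ∘ₗ v₁ = v₂ ∘ₗ a) (h₂ : b' ∘ₗ v₂ = v₃ ∘ₗ a')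
    (ha' : Function.Surjective a') (hbInj : Function.Injective b)
    (hb' : Function.Surjective b') :
    ∃ (e₁ : LinearMap.ker v₁ →ₗ[K] LinearMap.ker v₂)
      (e₂ : LinearMap.ker v₂ →ₗ[K] LinearMap.ker v₃)
      (δ : LinearMap.ker v₃ →ₗ[K] (B₁ ⧸ LinearMap.range v₁))
      (q₁ : (B₁ ⧸ LinearMap.range v₁) →ₗ[K] (B₂ ⧸ LinearMap.range v₂))
      (q₂ : (B₂ ⧸ LinearMap.range v₂) →ₗ[K] (B₃ ⧸ LinearMap.range v₃)),
      (∀ x, (e₁ x : A₂) = a x.1) ∧ (∀ y, (e₂ y : A₃) = a' y.1) ∧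
      (∀ x, q₁ ((LinearMap.range v₁).mkQ x) = (LinearMap.range v₂).mkQ (b x)) ∧
      (∀ y, q₂ ((LinearMap.range v₂).mkQ y) = (LinearMap.range v₃).mkQ (b' y)) ∧
      LinearMap.range e₁ = LinearMap.ker e₂ ∧ LinearMap.range e₂ = LinearMap.ker δ ∧
      LinearMap.range δ = LinearMap.ker q₁ ∧ LinearMap.range q₁ = LinearMap.ker q₂ ∧
      Function.Surjective q₂ := by
  have c₁ (x : A₁) : b (v₁ x) = v₂ (a x) := LinearMap.congr_fun h₁ x
  have c₂ (x : A₂) : b' (v₂ x) = v₃ (a' x) := LinearMap.congr_fun h₂ x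
  have k₁ : ∀ x ∈ LinearMap.ker v₁, a x ∈ LinearMap.ker v₂ := fun x hx => by
    rw [LinearMap.mem_ker, ← c₁, LinearMap.mem_ker.1 hx, map_zero]
  have k₂ : ∀ x ∈ LinearMap.ker v₂, a' x ∈ LinearMap.ker v₃ := fun x hx => by
    rw [LinearMap.mem_ker, ← c₂, LinearMap.mem_ker.1 hx, map_zero]
  have r₁ : LinearMap.range v₁ ≤ (LinearMap.range v₂).comap b := by
    rintro _ ⟨x, rfl⟩
    exact ⟨a x, (c₁ x).symm⟩
  have r₂ : LinearMap.range v₂ ≤ (LinearMap.range v₃).comap b' := by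
    rintro _ ⟨x, rfl⟩
    exact ⟨a' x, (c₂ x).symm⟩
  have hι₂ : Function.Exact (LinearMap.ker v₂).subtype v₂ := v₂.exact_subtype_ker_map
  have hι₃ : Function.Exact (LinearMap.ker v₃).subtype v₃ := v₃.exact_subtype_ker_map
  have hπ₁ : Function.Exact v₁ (LinearMap.range v₁).mkQ := v₁.exact_map_mkQ_range
  have hπ₂ : Function.Exact v₂ (LinearMap.range v₂).mkQ := v₂.exact_map_mkQ_range
  refine ⟨a.restrict k₁, a'.restrict k₂,
    SnakeLemma.δ' v₁ v₂ v₃ a a' ha b b' hb h₁ h₂ _ hι₃ _ hπ₁ ha' hbInj,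
    Submodule.mapQ _ _ b r₁, Submodule.mapQ _ _ b' r₂,
    fun _ => rfl, fun _ => rfl, fun _ => rfl, fun _ => rfl, ?_, ?_, ?_, ?_, ?_⟩
  · ext ⟨y, hy⟩
    constructor
    · rintro ⟨x, hx⟩
      rw [← hx]
      exact Subtype.ext (ha.apply_apply_eq_zero x.1)
    · intro h
      obtain ⟨x, rfl⟩ := (ha y).1 (congrArg Subtype.val h)
      refine ⟨⟨x, hbInj ?_⟩, rfl⟩
      rw [c₁, map_zero, LinearMap.mem_ker.1 hy]
  · exact (SnakeLemma.exact_δ'_right v₁ v₂ v₃ a a' ha b b' hb h₁ h₂ _ hι₂ _ hι₃ _ hπ₁ ha' hbInj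
      (a'.restrict k₂) rfl Subtype.val_injective).linearMap_ker_eq.symm
  · exact (SnakeLemma.exact_δ'_left v₁ v₂ v₃ a a' ha b b' hb h₁ h₂ _ hι₃ _ hπ₁ _ hπ₂ ha' hbInj
      (Submodule.mapQ _ _ b r₁) rfl (Submodule.mkQ_surjective _)).linearMap_ker_eq.symm
  · ext y
    obtain ⟨y, rfl⟩ := Submodule.mkQ_surjective _ y
    constructor
    · rintro ⟨x, hx⟩
      obtain ⟨x, rfl⟩ := Submodule.mkQ_surjective _ x
      rw [← hx]
      exact congrArg (LinearMap.range v₃).mkQ (hb.apply_apply_eq_zero x) |>.trans (map_zero _)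
    · intro h
      obtain ⟨n, hn⟩ := (Submodule.Quotient.mk_eq_zero _).1 h
      obtain ⟨m, rfl⟩ := ha' n
      obtain ⟨x, hx⟩ := (hb (y - v₂ m)).1 (by rw [map_sub, c₂, hn, sub_self])
      refine ⟨(LinearMap.range v₁).mkQ x, (Submodule.Quotient.eq _).2 ⟨-m, ?_⟩⟩
      rw [hx, map_neg]
      abel
  · intro z
    obtain ⟨z, rfl⟩ := Submodule.mkQ_surjective _ z
    obtain ⟨y, rfl⟩ := hb' z
    exact ⟨(LinearMap.range v₂).mkQ y, rfl⟩

end Snake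

/-- A short exact sequence `0 → (L,0) → (M,∂) → (N,∂′) → 0` of crossed
`P`-modules induces a six-term exact sequence
`H̄₁(P,L) → H̄₁(P,M) → H̄₁(P,N) → H̄₀(P,L) → H̄₀(P,M) → H̄₀(P,N) → 0`. -/
theorem statement11 {K : Type} [CommRing K] (P L M N : LieSuperalgebra K)
    (cmL : CrossedModule L P) (cmM : CrossedModule M P) (cmN : CrossedModule N P)
    -- `(L, 0)`: the structure map of `L` is zero and `L` is abelian
    (hL0 : cmL.d.toLinear = 0) (hLab : ∀ x y : L.carrier, L.bracket x y = 0)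
    -- the short exact sequence of crossed `P`-modules
    (f : CMHom cmL cmM) (g : CMHom cmM cmN)
    (hfInj : Function.Injective f.hom.toLinear)
    (hgSurj : Function.Surjective g.hom.toLinear)
    (hfg : LinearMap.range f.hom.toLinear = LinearMap.ker g.hom.toLinear)
    -- each `X ∈ {L, M, N}` acts on `P` via its structure map and the bracket of `P`
    (aLP : LieSuperAction L P)
    (haLP : ∀ (x : L.carrier) (p : P.carrier), aLP.act x p = P.bracket (cmL.d.toLinear x) p)
    (aMP : LieSuperAction M P)
    (haMP : ∀ (x : M.carrier) (p : P.carrier), aMP.act x p = P.bracket (cmM.d.toLinear x) p)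
    (aNP : LieSuperAction N P)
    (haNP : ∀ (x : N.carrier) (p : P.carrier), aNP.act x p = P.bracket (cmN.d.toLinear x) p)
    -- the non-abelian tensor products `P ⊗ L`, `P ⊗ M`, `P ⊗ N`
    (TL : LieSuperalgebra K) (ιL : TensorData cmL.act aLP TL)
    (hTL : IsNATensor cmL.act aLP TL ιL)
    (TM : LieSuperalgebra K) (ιM : TensorData cmM.act aMP TM)
    (hTM : IsNATensor cmM.act aMP TM ιM)
    (TN : LieSuperalgebra K) (ιN : TensorData cmN.act aNP TN)
    (hTN : IsNATensor cmN.act aNP TN ιN)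
    -- the homomorphisms `ν : P ⊗ X → X`
    (νL : LieSuperHom TL L)
    (hνL : ∀ (α β : ZMod 2) (p : P.grading α) (x : L.grading β),
      νL.toLinear (ιL.pair α β p x) = cmL.act.act p.1 x.1)
    (νM : LieSuperHom TM M)
    (hνM : ∀ (α β : ZMod 2) (p : P.grading α) (x : M.grading β),
      νM.toLinear (ιM.pair α β p x) = cmM.act.act p.1 x.1)
    (νN : LieSuperHom TN N)
    (hνN : ∀ (α β : ZMod 2) (p : P.grading α) (x : N.grading β),
      νN.toLinear (ιN.pair α β p x) = cmN.act.act p.1 x.1)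
    -- the induced homomorphisms between the tensor products
    (Tf : LieSuperHom TL TM)
    (hTf : ∀ (α β : ZMod 2) (p : P.grading α) (x : L.grading β),
      Tf.toLinear (ιL.pair α β p x)
        = ιM.pair α β p ⟨f.hom.toLinear x.1, f.hom.map_grading β x.1 x.2⟩)
    (Tg : LieSuperHom TM TN)
    (hTg : ∀ (α β : ZMod 2) (p : P.grading α) (x : M.grading β),
      Tg.toLinear (ιM.pair α β p x)
        = ιN.pair α β p ⟨g.hom.toLinear x.1, g.hom.map_grading β x.1 x.2⟩) :
    -- the six-term exact sequence
    ∃ (e₁ : (LinearMap.ker νL.toLinear : Submodule K TL.carrier) →ₗ[K]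
          (LinearMap.ker νM.toLinear : Submodule K TM.carrier))
      (e₂ : (LinearMap.ker νM.toLinear : Submodule K TM.carrier) →ₗ[K]
          (LinearMap.ker νN.toLinear : Submodule K TN.carrier))
      (δ : (LinearMap.ker νN.toLinear : Submodule K TN.carrier) →ₗ[K]
          (L.carrier ⧸ LinearMap.range νL.toLinear))
      (q₁ : (L.carrier ⧸ LinearMap.range νL.toLinear) →ₗ[K]
          (M.carrier ⧸ LinearMap.range νM.toLinear))
      (q₂ : (M.carrier ⧸ LinearMap.range νM.toLinear) →ₗ[K]
          (N.carrier ⧸ LinearMap.range νN.toLinear)),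
      -- the maps on `H̄₁` and `H̄₀` are the induced ones
      (∀ x : LinearMap.ker νL.toLinear, (e₁ x : TM.carrier) = Tf.toLinear x.1) ∧
      (∀ y : LinearMap.ker νM.toLinear, (e₂ y : TN.carrier) = Tg.toLinear y.1) ∧
      (∀ x : L.carrier, q₁ ((LinearMap.range νL.toLinear).mkQ x)
        = (LinearMap.range νM.toLinear).mkQ (f.hom.toLinear x)) ∧
      (∀ y : M.carrier, q₂ ((LinearMap.range νM.toLinear).mkQ y)
        = (LinearMap.range νN.toLinear).mkQ (g.hom.toLinear y)) ∧
      -- exactness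
      LinearMap.range e₁ = LinearMap.ker e₂ ∧
      LinearMap.range e₂ = LinearMap.ker δ ∧
      LinearMap.range δ = LinearMap.ker q₁ ∧
      LinearMap.range q₁ = LinearMap.ker q₂ ∧
      Function.Surjective q₂ := by
  refine exists_snake_sequence νL.toLinear νM.toLinear νN.toLinear Tf.toLinear Tg.toLinear
    f.hom.toLinear g.hom.toLinear ?_ ?_ ?_ ?_ (surjective_tensor_map hgSurj hTN hTg) hfInj hgSurj
  · exact LinearMap.exact_iff.2 (range_tensor_map_eq_ker hL0 hgSurj hfg haMP haNP hTL hTM hTN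
      hTf hTg).symm
  · exact LinearMap.exact_iff.2 hfg.symm
  · refine hTL.linearMap_ext fun α β p x => ?_
    rw [LinearMap.comp_apply, LinearMap.comp_apply, hνL, hTf, hνM, f.equivariant]
  · refine hTM.linearMap_ext fun α β p x => ?_
    rw [LinearMap.comp_apply, LinearMap.comp_apply, hνM, hTg, hνN, g.equivariant]

end SuperNA
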